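/- Let G be a homogeneous m-generic L-graph such that O(G) contains a C_{01}-cover set 𝒜. Then there is a good C_{01}-cover set ℬ ∈ Λ based on 𝒜, i.e. with Ω_{01}(ℬ) ⊆ Ω_{01}(𝒜). -/

import Mathlib

/-!
Common framework: coloured multipartite graphs in a finite language `L`.
Colours are natural numbers; for each pair of distinct parts `i j : Fin m`
there is a finite nonempty colour set `C i j`.
-/

/-- A finite language for coloured `m`-partite graphs. -/
structure MLang (m : ℕ) where
  C : Fin m → Fin m → Finset ℕ
  symm : ∀ i j, C i j = C j i
  nonempty : ∀ i j, i ≠ j → (C i j).Nonempty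

/-- A coloured `m`-partite `L`-graph: vertices partitioned into parts `V_0, …, V_{m-1}`,
with a symmetric colouring of cross-part pairs taking values in the colour sets of `L`.
(The value of `colour` on pairs within a part is irrelevant junk data.) -/
structure LGraph {m : ℕ} (L : MLang m) where
  V : Type
  part : V → Fin m
  colour : V → V → ℕ
  colour_symm : ∀ x y, colour x y = colour y x
  colour_mem : ∀ x y, part x ≠ part y → colour x y ∈ L.C (part x) (part y)

namespace LGraph

variable {m : ℕ} {L : MLang m}

/-- The induced subgraph of `A` on a set `S` of its vertices. -/
def restrict (A : LGraph L) (S : Set A.V) : LGraph L where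
  V := S
  part x := A.part x.1
  colour x y := A.colour x.1 y.1
  colour_symm := fun x y => A.colour_symm x.1 y.1
  colour_mem := fun x y h => A.colour_mem x.1 y.1 h

/-- `f` is an embedding of `A` into `G`: injective, part-preserving, colour-preserving. -/
def IsEmbedding (A G : LGraph L) (f : A.V → G.V) : Prop :=
  Function.Injective f ∧ (∀ x, G.part (f x) = A.part x) ∧
    ∀ x y : A.V, A.part x ≠ A.part y → G.colour (f x) (f y) = A.colour x y

/-- `A` is realized in `G`, i.e. `A` embeds into `G`. -/
def Realized (G A : LGraph L) : Prop := ∃ f : A.V → G.V, IsEmbedding A G f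

/-- `A` and `B` are isomorphic `L`-graphs. -/
def IsIsomorphic (A B : LGraph L) : Prop :=
  ∃ f : A.V → B.V, IsEmbedding A B f ∧ Function.Surjective f

/-- `φ` restricted to `S` is an isomorphism between induced subgraphs of `G`
(a partial automorphism of `G`). -/
def IsPartialIso (G : LGraph L) (S : Set G.V) (φ : G.V → G.V) : Prop :=
  Set.InjOn φ S ∧ (∀ x ∈ S, G.part (φ x) = G.part x) ∧
    ∀ x ∈ S, ∀ y ∈ S, G.part x ≠ G.part y → G.colour (φ x) (φ y) = G.colour x y

/-- `G` is homogeneous: every isomorphism between finite induced subgraphs of `G`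
extends to an automorphism of `G`. -/
def Homogeneous (G : LGraph L) : Prop :=
  ∀ S : Set G.V, S.Finite → ∀ φ : G.V → G.V, G.IsPartialIso S φ →
    ∃ ψ : G.V ≃ G.V, (∀ x, G.part (ψ x) = G.part x) ∧
      (∀ x y : G.V, G.part x ≠ G.part y → G.colour (ψ x) (ψ y) = G.colour x y) ∧
      ∀ x ∈ S, ψ x = φ x

/-- `G` is `m`-generic: every part is countably infinite and every bipartite
restriction is generic. -/
def Generic (G : LGraph L) : Prop :=
  Countable G.V ∧ (∀ i : Fin m, {x : G.V | G.part x = i}.Infinite) ∧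
    ∀ i j : Fin m, i ≠ j → ∀ U : Finset G.V, (∀ u ∈ U, G.part u = i) →
      ∀ f : G.V → ℕ, (∀ u ∈ U, f u ∈ L.C i j) →
        ∃ x : G.V, G.part x = j ∧ ∀ u ∈ U, G.colour x u = f u

/-- `A` is minimally omitted from `G` (membership in `O(G)`): `A` is finite and omitted,
but every proper induced subgraph of `A` is realized in `G`. -/
def MinOmitted (G A : LGraph L) : Prop :=
  Finite A.V ∧ ¬ G.Realized A ∧ ∀ S : Set A.V, S ≠ Set.univ → G.Realized (A.restrict S)

/-- `A` is monic: at most one vertex in each part. -/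
def Monic (A : LGraph L) : Prop := ∀ x y : A.V, A.part x = A.part y → x = y

/-- `A` covers colour `c` on the restriction `V_i V_j`: it has vertices in `V_i` and `V_j`
joined by a `c`-coloured edge. -/
def Covers (A : LGraph L) (i j : Fin m) (c : ℕ) : Prop :=
  ∃ x y : A.V, A.part x = i ∧ A.part y = j ∧ A.colour x y = c

/-- `A` is an `ijk`-triangle: a monic with vertices in exactly the parts `V_i, V_j, V_k`. -/
def IsTriangleOn (A : LGraph L) (i j k : Fin m) : Prop :=
  A.Monic ∧ (∀ x : A.V, A.part x = i ∨ A.part x = j ∨ A.part x = k) ∧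
    (∃ x : A.V, A.part x = i) ∧ (∃ x : A.V, A.part x = j) ∧ (∃ x : A.V, A.part x = k)

/-- `A` is a triangle: an `ijk`-triangle for some pairwise distinct `i, j, k`. -/
def IsTriangle (A : LGraph L) : Prop :=
  ∃ i j k : Fin m, i ≠ j ∧ i ≠ k ∧ j ≠ k ∧ A.IsTriangleOn i j k

end LGraph

open LGraph

variable {m : ℕ} {L : MLang m}

/-- A `C_{ij}`-cover set: a set of monics covering every colour of `C i j` on `V_i V_j`. -/
def IsCoverSet (𝒜 : Set (LGraph L)) (i j : Fin m) : Prop :=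
  (∀ A ∈ 𝒜, A.Monic) ∧ ∀ c ∈ L.C i j, ∃ A ∈ 𝒜, A.Covers i j c

/-- A `C_{ij}^{kl}`-omission set with code `(i,j,k,l; cik, cil, cjk, cjl)`:
a `C_{ij}`-cover set of `ijk`-triangles and `ijl`-triangles all of whose
`E_{ik}, E_{il}, E_{jk}, E_{jl}`-edges have the indicated colours. -/
def IsOmissionSet (S : Set (LGraph L)) (i j k l : Fin m) (cik cil cjk cjl : ℕ) : Prop :=
  IsCoverSet S i j ∧
  (∀ A ∈ S, A.IsTriangleOn i j k ∨ A.IsTriangleOn i j l) ∧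
  (∀ A ∈ S, ∀ x y : A.V, A.part x = i → A.part y = k → A.colour x y = cik) ∧
  (∀ A ∈ S, ∀ x y : A.V, A.part x = i → A.part y = l → A.colour x y = cil) ∧
  (∀ A ∈ S, ∀ x y : A.V, A.part x = j → A.part y = k → A.colour x y = cjk) ∧
  (∀ A ∈ S, ∀ x y : A.V, A.part x = j → A.part y = l → A.colour x y = cjl)

/-- The code `(i,j,k,l; cik, cil, cjk, cjl)` is based on the cover set `𝒜`. -/
def BasedOn (𝒜 : Set (LGraph L)) (i j k l : Fin m) (cik cil cjk cjl : ℕ) : Prop :=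
  ∃ A ∈ 𝒜, ∃ A' ∈ 𝒜,
    A.Covers i k cik ∧ A.Covers j k cjk ∧ A'.Covers i l cil ∧ A'.Covers j l cjl

/-- The code `(i,j,k,l; cik, cil, cjk, cjl)` is based on triangles from the cover set `𝒜`. -/
def BasedOnTriangles (𝒜 : Set (LGraph L)) (i j k l : Fin m) (cik cil cjk cjl : ℕ) : Prop :=
  ∃ A ∈ 𝒜, ∃ A' ∈ 𝒜, A.IsTriangle ∧ A'.IsTriangle ∧
    A.Covers i k cik ∧ A.Covers j k cjk ∧ A'.Covers i l cil ∧ A'.Covers j l cjl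

/-- The age of `G`: the class of finite `L`-graphs embedding into `G`. -/
def Age (G : LGraph L) : Set (LGraph L) := {A | Finite A.V ∧ G.Realized A}

/-- `Forb F`: the class of finite `L`-graphs into which no member of `F` embeds. -/
def Forb (F : Set (LGraph L)) : Set (LGraph L) :=
  {B | Finite B.V ∧ ∀ A ∈ F, ¬ B.Realized A}

/-- An amalgamation class: a class of finite `L`-graphs closed under isomorphism and
induced subgraphs with the amalgamation property. -/
def IsAmalgamationClass (𝒞 : Set (LGraph L)) : Prop :=
  (∀ A ∈ 𝒞, Finite A.V) ∧
  (∀ A ∈ 𝒞, ∀ B : LGraph L, A.IsIsomorphic B → B ∈ 𝒞) ∧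
  (∀ A ∈ 𝒞, ∀ S : Set A.V, A.restrict S ∈ 𝒞) ∧
  ∀ A B₁ B₂ : LGraph L, A ∈ 𝒞 → B₁ ∈ 𝒞 → B₂ ∈ 𝒞 →
    ∀ (f₁ : A.V → B₁.V) (f₂ : A.V → B₂.V),
      IsEmbedding A B₁ f₁ → IsEmbedding A B₂ f₂ →
      ∃ C ∈ 𝒞, ∃ (g₁ : B₁.V → C.V) (g₂ : B₂.V → C.V),
        IsEmbedding B₁ C g₁ ∧ IsEmbedding B₂ C g₂ ∧ g₁ ∘ f₁ = g₂ ∘ f₂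

section Parts01

variable [NeZero m]

/-- `A ≤₀₁ B`: `A` is an off-`E_{01}`-subgraph of `B`, i.e. `A` embeds into `B` ignoring
the colours of edges between `V_0` and `V_1` (equivalently, `A` embeds into the graph
obtained from `B` by recolouring its `E_{01}`-edge with the `E_{01}`-colour of `A`). -/
def Le01 (A B : LGraph L) : Prop :=
  ∃ f : A.V → B.V, Function.Injective f ∧ (∀ x, B.part (f x) = A.part x) ∧
    ∀ x y : A.V, A.part x ≠ A.part y →
      ¬((A.part x = 0 ∧ A.part y = 1) ∨ (A.part x = 1 ∧ A.part y = 0)) →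
      B.colour (f x) (f y) = A.colour x y

/-- `A` and `B` are off-`E_{01}`-isomorphic. -/
def OffIso01 (A B : LGraph L) : Prop := Le01 A B ∧ Le01 B A

/-- `A` is a maximal element of the quasi-order `(𝒜, ≤₀₁)`. -/
def MaxIn (𝒜 : Set (LGraph L)) (A : LGraph L) : Prop :=
  A ∈ 𝒜 ∧ ∀ B ∈ 𝒜, Le01 A B → Le01 B A

/-- `𝒜 ∈ Λ`: a `C_{01}`-cover set contained in `O(G)` of size exactly `|C_{01}|`. -/
def InLambda (G : LGraph L) (𝒜 : Set (LGraph L)) : Prop :=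
  (∀ A ∈ 𝒜, G.MinOmitted A) ∧ IsCoverSet 𝒜 0 1 ∧ 𝒜.ncard = (L.C 0 1).card

/-- The graph obtained from `A` by recolouring its `E_{01}`-edge with `α`
(that is, `A^{c/α}` where `c` is the `E_{01}`-colour of `A`) is realized in `G`. -/
def RealizedRecoloured01 (G A : LGraph L) (α : ℕ) : Prop :=
  ∃ f : A.V → G.V, Function.Injective f ∧ (∀ x, G.part (f x) = A.part x) ∧
    (∀ x y : A.V, A.part x ≠ A.part y →
      ¬((A.part x = 0 ∧ A.part y = 1) ∨ (A.part x = 1 ∧ A.part y = 0)) →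
      G.colour (f x) (f y) = A.colour x y) ∧
    ∀ x y : A.V, A.part x = 0 → A.part y = 1 → G.colour (f x) (f y) = α

/-- `Ω₀₁(𝒜) ⊆ Ω₀₁(ℬ)`: every code `(0,1,k,l; c_{0k}, c_{0l}, c_{1k}, c_{1l})`
based on `𝒜` is based on `ℬ`. -/
def Omega01Le (𝒜 ℬ : Set (LGraph L)) : Prop :=
  ∀ k l : Fin m, k ≠ l → k ≠ 0 → k ≠ 1 → l ≠ 0 → l ≠ 1 →
    ∀ c0k c0l c1k c1l : ℕ,
      BasedOn 𝒜 0 1 k l c0k c0l c1k c1l → BasedOn ℬ 0 1 k l c0k c0l c1k c1l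

/-- `ℬ` is a good `C_{01}`-cover set (for `G`): there is a key colour `α ∈ C_{01}` with key
monic `A^α ∈ ℬ` such that every member of `ℬ`, after recolouring its `E_{01}`-edge by `α`,
is either an (off-`E_{01}`-)subgraph of `A^α` or realized in `G`. -/
def GoodCoverSet (G : LGraph L) (ℬ : Set (LGraph L)) : Prop :=
  ∃ α ∈ L.C 0 1, ∃ Aα ∈ ℬ, Aα.Covers 0 1 α ∧
    ∀ A ∈ ℬ, Le01 A Aα ∨ RealizedRecoloured01 G A α

/-- `ℬ` is a star `C_{01}`-cover set: good, with a key monic which either has vertices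
in at least four parts, or has vertices in exactly three parts `V_0, V_1, V_i` while no
other member of `ℬ` has vertices in all of the remaining parts. -/
def StarCoverSet (G : LGraph L) (ℬ : Set (LGraph L)) : Prop :=
  ∃ α ∈ L.C 0 1, ∃ Aα ∈ ℬ, Aα.Covers 0 1 α ∧
    (∀ A ∈ ℬ, Le01 A Aα ∨ RealizedRecoloured01 G A α) ∧
    (4 ≤ (Set.range Aα.part).ncard ∨
      ∃ i : Fin m, i ≠ 0 ∧ i ≠ 1 ∧ Set.range Aα.part = {0, 1, i} ∧
        ∀ B ∈ ℬ, B ≠ Aα → ∃ p : Fin m, p ≠ 0 ∧ p ≠ 1 ∧ p ≠ i ∧ p ∉ Set.range B.part)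

/-- `B` is a copy of the monic `B^{cd}` (relative to the background colours `α`): a monic
with exactly one vertex in every part, `E_{01}`-colour `c`, `E_{12}`-colour `d`, and
`E_{ij}`-colour `α i j` for every other pair of distinct parts. -/
def IsBcd (B : LGraph L) (α : Fin m → Fin m → ℕ) (c d : ℕ) : Prop :=
  B.Monic ∧ (∀ i : Fin m, ∃ x : B.V, B.part x = i) ∧
  (∀ x y : B.V, B.part x = 0 → B.part y = 1 → B.colour x y = c) ∧
  (∀ x y : B.V, B.part x = 1 → B.part y = 2 → B.colour x y = d) ∧
  (∀ x y : B.V, B.part x ≠ B.part y →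
    ¬((B.part x = 0 ∧ B.part y = 1) ∨ (B.part x = 1 ∧ B.part y = 0)) →
    ¬((B.part x = 1 ∧ B.part y = 2) ∨ (B.part x = 2 ∧ B.part y = 1)) →
    B.colour x y = α (B.part x) (B.part y))

end Parts01

section Helpers

variable {m : ℕ} [NeZero m] {L : MLang m}

theorem le01_refl (A : LGraph L) : Le01 A A :=
  ⟨id, Function.injective_id, fun _ => rfl, fun _ _ _ _ => rfl⟩

theorem le01_trans {A B C : LGraph L} (h₁ : Le01 A B) (h₂ : Le01 B C) : Le01 A C := by
  obtain ⟨f, hf, hfp, hfc⟩ := h₁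
  obtain ⟨g, hg, hgp, hgc⟩ := h₂
  refine ⟨g ∘ f, hg.comp hf, fun x => by simp [hgp, hfp], fun x y hxy h01 => ?_⟩
  rw [← hfc x y hxy h01]
  apply hgc
  · simpa [hfp] using hxy
  · simpa [hfp] using h01

/-- If `A ≤₀₁ B` then `A` is off-isomorphic to an induced subgraph of `B`. -/
theorem le01_exists_restrict {A B : LGraph L} (h : Le01 A B) :
    ∃ S : Set B.V, Le01 A (B.restrict S) ∧ Le01 (B.restrict S) A := by
  obtain ⟨f, hf, hfp, hfc⟩ := h
  refine ⟨Set.range f, ⟨fun x => ⟨f x, x, rfl⟩, ?_, hfp, hfc⟩, ?_⟩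
  · intro x y hxy
    exact hf (congrArg Subtype.val hxy)
  · have hx : ∀ x : Set.range f, ∃ y, f y = x.1 := fun x => x.2
    choose g hg using hx
    have hgp : ∀ x : Set.range f, A.part (g x) = B.part x.1 := fun x => by
      rw [← hfp, hg]
    refine ⟨g, ?_, hgp, ?_⟩
    · intro x y hxy
      apply Subtype.ext
      rw [← hg x, ← hg y, hxy]
    · have aux : ∀ x y : Set.range f, B.part x.1 ≠ B.part y.1 →
          ¬((B.part x.1 = 0 ∧ B.part y.1 = 1) ∨ (B.part x.1 = 1 ∧ B.part y.1 = 0)) →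
          A.colour (g x) (g y) = B.colour x.1 y.1 := by
        intro x y hxy h01
        rw [← hgp, ← hgp] at hxy
        rw [← hgp, ← hgp] at h01
        rw [← hfc _ _ hxy h01, hg, hg]
      exact aux

/-- Covering an edge outside `E₀₁` transfers along `≤₀₁`. -/
theorem covers_of_le01 {A B : LGraph L} (h : Le01 A B) {i k : Fin m} {c : ℕ}
    (hik : i ≠ k) (hk0 : k ≠ 0) (hk1 : k ≠ 1) (hc : A.Covers i k c) : B.Covers i k c := by
  obtain ⟨f, hf, hfp, hfc⟩ := h
  obtain ⟨x, y, hx, hy, hxy⟩ := hc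
  refine ⟨f x, f y, by rw [hfp, hx], by rw [hfp, hy], ?_⟩
  rw [hfc x y, hxy]
  · rw [hx, hy]; exact hik
  · rw [hx, hy]; tauto

/-- Recolour all `E₀₁`-edges of `A` by `α`. -/
noncomputable def recolour01 (A : LGraph L) (α : ℕ) (hα : α ∈ L.C 0 1) : LGraph L := by
  classical
  exact
  { V := A.V
    part := A.part
    colour := fun x y =>
      if (A.part x = 0 ∧ A.part y = 1) ∨ (A.part x = 1 ∧ A.part y = 0) then α else A.colour x y
    colour_symm := by
      intro x y
      have : ((A.part x = 0 ∧ A.part y = 1) ∨ (A.part x = 1 ∧ A.part y = 0)) ↔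
        ((A.part y = 0 ∧ A.part x = 1) ∨ (A.part y = 1 ∧ A.part x = 0)) := by tauto
      simp only [this, A.colour_symm x y]
    colour_mem := by
      intro x y hxy
      split_ifs with h
      · rcases h with ⟨h0, h1⟩ | ⟨h1, h0⟩
        · rw [h0, h1]; exact hα
        · rw [h0, h1, L.symm]; exact hα
      · exact A.colour_mem x y hxy }

/-- The replacement step. -/
theorem exists_replacement (h01 : (0 : Fin m) ≠ 1) (G A : LGraph L) {α c : ℕ}
    (hα : α ∈ L.C 0 1) (hA : G.MinOmitted A) (hmon : A.Monic) (hc : A.Covers 0 1 c)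
    (hnr : ¬ RealizedRecoloured01 G A α) :
    ∃ B : LGraph L, G.MinOmitted B ∧ B.Monic ∧ B.Covers 0 1 α ∧ Le01 B A := by
  classical
  obtain ⟨hfin, hom, hmin⟩ := hA
  obtain ⟨x0, y0, hx0, hy0, -⟩ := hc
  set A' := recolour01 A α hα with hA'
  have hcol : ∀ x y : A.V, A'.colour x y =
      if (A.part x = 0 ∧ A.part y = 1) ∨ (A.part x = 1 ∧ A.part y = 0) then α
        else A.colour x y := fun x y => rfl
  have huniv : ¬ G.Realized (A'.restrict Set.univ) := by
    rintro ⟨f, hf, hfp, hfc⟩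
    apply hnr
    refine ⟨fun x => f ⟨x, trivial⟩, ?_, fun x => hfp ⟨x, trivial⟩, ?_, ?_⟩
    · intro x y hxy
      exact congrArg Subtype.val (hf hxy)
    · intro x y hxy hn
      have := hfc ⟨x, trivial⟩ ⟨y, trivial⟩ hxy
      rw [this]
      change A'.colour x y = _
      rw [hcol, if_neg hn]
    · intro x y hx hy
      have := hfc ⟨x, trivial⟩ ⟨y, trivial⟩ (by
        change A.part x ≠ A.part y
        rw [hx, hy]; exact h01)
      rw [this]
      change A'.colour x y = _
      rw [hcol, if_pos (Or.inl ⟨hx, hy⟩)]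
  have : Finite (Set A.V) := inferInstance
  obtain ⟨S, hS⟩ := (Set.toFinite {S : Set A.V | ¬ G.Realized (A'.restrict S)}).exists_minimal
    ⟨Set.univ, huniv⟩
  have hSo : ¬ G.Realized (A'.restrict S) := hS.1
  have hSmin : ∀ T : Set A.V, T ⊆ S → T ≠ S → G.Realized (A'.restrict T) := by
    intro T hT hne
    by_contra hcon
    exact hne (Set.Subset.antisymm hT (hS.2 hcon hT))
  -- a subset missing the `0` or `1` vertex carries no `E₀₁`-edge
  have key : ∀ z : A.V, (z = x0 ∨ z = y0) → z ∈ S := by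
    intro z hz
    by_contra hzS
    apply hSo
    obtain ⟨f, hf, hfp, hfc⟩ := hmin S (fun h => hzS (h ▸ trivial))
    refine ⟨f, hf, hfp, ?_⟩
    intro x y hxy
    have := hfc x y hxy
    refine this.trans (Eq.trans ?_ (hcol x.1 y.1).symm)
    refine (if_neg ?_).symm
    rintro (⟨h0, h1⟩ | ⟨h1, h0⟩)
    · have e0 : x.1 = x0 := hmon _ _ (h0.trans hx0.symm)
      have e1 : y.1 = y0 := hmon _ _ (h1.trans hy0.symm)
      rcases hz with rfl | rfl
      · exact hzS (e0 ▸ x.2)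
      · exact hzS (e1 ▸ y.2)
    · have e0 : y.1 = x0 := hmon _ _ (h0.trans hx0.symm)
      have e1 : x.1 = y0 := hmon _ _ (h1.trans hy0.symm)
      rcases hz with rfl | rfl
      · exact hzS (e0 ▸ y.2)
      · exact hzS (e1 ▸ x.2)
  refine ⟨A'.restrict S, ⟨?_, hSo, ?_⟩, ?_, ?_, ?_⟩
  · exact (inferInstance : Finite S)
  · intro T hT
    obtain ⟨f, hf, hfp, hfc⟩ := hSmin (Subtype.val '' (T : Set S)) (by
      rintro _ ⟨x, -, rfl⟩; exact x.2) (by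
      intro h
      apply hT
      ext x
      simp only [Set.mem_univ, iff_true]
      have hx : x.1 ∈ Subtype.val '' (T : Set S) := h.symm ▸ x.2
      obtain ⟨y, hy, hyx⟩ := hx
      exact (Subtype.ext hyx : y = x) ▸ hy)
    refine ⟨fun x => f ⟨x.1.1, x.1, x.2, rfl⟩, ?_, fun x => hfp ⟨x.1.1, x.1, x.2, rfl⟩,
      fun x y hxy => hfc ⟨x.1.1, x.1, x.2, rfl⟩ ⟨y.1.1, y.1, y.2, rfl⟩ hxy⟩
    intro x y hxy
    have := congrArg Subtype.val (hf hxy)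
    exact Subtype.ext (Subtype.ext this)
  · intro x y hxy
    exact Subtype.ext (hmon x.1 y.1 hxy)
  · refine ⟨⟨x0, key x0 (Or.inl rfl)⟩, ⟨y0, key y0 (Or.inr rfl)⟩, hx0, hy0, ?_⟩
    change A'.colour x0 y0 = α
    rw [hcol, if_pos (Or.inl ⟨hx0, hy0⟩)]
  · refine ⟨Subtype.val, Subtype.val_injective, fun x => rfl, ?_⟩
    intro x y hxy hn
    exact ((hcol x.1 y.1).trans (if_neg hn)).symm

end Helpers

theorem exists_good_coverset_based_on
    {m : ℕ} [NeZero m] {L : MLang m} (hm : 2 ≤ m)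
    (G : LGraph L) (hG : G.Homogeneous) (hgen : G.Generic)
    (𝒜 : Set (LGraph L)) (h𝒜 : ∀ A ∈ 𝒜, G.MinOmitted A)
    (hcov : IsCoverSet 𝒜 0 1) :
    ∃ ℬ : Set (LGraph L), InLambda G ℬ ∧ GoodCoverSet G ℬ ∧ Omega01Le ℬ 𝒜 := by
  classical
  have h01 : (0 : Fin m) ≠ 1 := by
    intro h
    have := congrArg Fin.val h
    rw [Fin.val_zero, Fin.val_one', Nat.mod_eq_of_lt (by omega)] at this
    omega
  obtain ⟨hmon, hcov⟩ := hcov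
  have hne := L.nonempty 0 1 h01
  let K := {c // c ∈ L.C 0 1}
  have : Nonempty K := ⟨⟨_, hne.choose_spec⟩⟩
  have hch : ∀ c : K, ∃ A ∈ 𝒜, A.Covers 0 1 c.1 := fun c => hcov c.1 c.2
  choose A0 hA0 hA0c using hch
  have : ∀ c, Finite (A0 c).V := fun c => (h𝒜 _ (hA0 c)).1
  -- valid families
  let Valid : (K → LGraph L) → Prop := fun a => ∀ d : K,
    G.MinOmitted (a d) ∧ (a d).Monic ∧ (a d).Covers 0 1 d.1 ∧ ∃ c, Le01 (a d) (A0 c)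
  have hV0 : Valid A0 := fun d =>
    ⟨h𝒜 _ (hA0 d), hmon _ (hA0 d), hA0c d, d, le01_refl _⟩
  let Phi : (K → LGraph L) → Set (Σ c : K, Set (A0 c).V) := fun a =>
    {p | ∃ d, Le01 ((A0 p.1).restrict p.2) (a d)}
  -- minimise the downward closure
  obtain ⟨a0, hVa0, ha0min⟩ : ∃ a, Valid a ∧ ∀ b, Valid b → (Phi a).ncard ≤ (Phi b).ncard := by
    have hex : ∃ n, ∃ a, Valid a ∧ (Phi a).ncard = n := ⟨_, A0, hV0, rfl⟩
    obtain ⟨a, ha, han⟩ := Nat.find_spec hex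
    exact ⟨a, ha, fun b hb => han ▸ Nat.find_min' hex ⟨b, hb, rfl⟩⟩
  -- a maximal element
  obtain ⟨ξ, hξ⟩ : ∃ ξ, ∀ e, Le01 (a0 ξ) (a0 e) → Le01 (a0 e) (a0 ξ) := by
    obtain ⟨ξ, hξ⟩ := Finite.exists_max (fun d : K => {e : K | Le01 (a0 e) (a0 d)}.ncard)
    refine ⟨ξ, fun e he => ?_⟩
    have hsub : {e' : K | Le01 (a0 e') (a0 ξ)} ⊆ {e' : K | Le01 (a0 e') (a0 e)} :=
      fun e' he' => le01_trans he' he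
    have heq := Set.eq_of_subset_of_ncard_le hsub (hξ e) (Set.toFinite _)
    have : e ∈ {e' : K | Le01 (a0 e') (a0 e)} := le01_refl _
    rw [← heq] at this
    exact this
  let Dom : (K → LGraph L) → Prop := fun a => ∀ d, ∃ e, Le01 (a d) (a0 e)
  let cls : (K → LGraph L) → Set K := fun a => {d | OffIso01 (a d) (a0 ξ)}
  obtain ⟨a1, hVa1, hDa1, ha1min⟩ : ∃ a, Valid a ∧ Dom a ∧
      ∀ b, Valid b → Dom b → (cls a).ncard ≤ (cls b).ncard := by
    have hex : ∃ n, ∃ a, Valid a ∧ Dom a ∧ (cls a).ncard = n :=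
      ⟨_, a0, hVa0, fun d => ⟨d, le01_refl _⟩, rfl⟩
    obtain ⟨a, ha, hda, han⟩ := Nat.find_spec hex
    exact ⟨a, ha, hda, fun b hb hdb => han ▸ Nat.find_min' hex ⟨b, hb, hdb, rfl⟩⟩
  -- the class is nonempty
  obtain ⟨α, hα⟩ : ∃ α, OffIso01 (a1 α) (a0 ξ) := by
    have hsub : Phi a1 ⊆ Phi a0 := by
      rintro p ⟨d, hd⟩
      obtain ⟨e, he⟩ := hDa1 d
      exact ⟨e, le01_trans hd he⟩
    have heq := Set.eq_of_subset_of_ncard_le hsub (ha0min a1 hVa1) (Set.toFinite _)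
    obtain ⟨c, hc⟩ := (hVa0 ξ).2.2.2
    obtain ⟨S, hS1, hS2⟩ := le01_exists_restrict hc
    have hp : (⟨c, S⟩ : Σ c : K, Set (A0 c).V) ∈ Phi a0 := ⟨ξ, hS2⟩
    rw [← heq] at hp
    obtain ⟨d, hd⟩ := hp
    have hXd : Le01 (a0 ξ) (a1 d) := le01_trans hS1 hd
    obtain ⟨e, he⟩ := hDa1 d
    exact ⟨d, le01_trans he (hξ e (le01_trans hXd he)), hXd⟩
  have hgood : ∀ c : K, Le01 (a1 c) (a1 α) ∨ RealizedRecoloured01 G (a1 c) α.1 := by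
    intro c
    by_contra hcon
    push Not at hcon
    obtain ⟨hnle, hnr⟩ := hcon
    obtain ⟨B, hB1, hB2, hB3, hB4⟩ := exists_replacement h01 G (a1 c) α.2 (hVa1 c).1
      (hVa1 c).2.1 (hVa1 c).2.2.1 hnr
    let a2 := Function.update a1 α B
    have h2α : a2 α = B := Function.update_self ..
    have h2d : ∀ d, d ≠ α → a2 d = a1 d := fun d hd => Function.update_of_ne hd ..
    have hV2 : Valid a2 := by
      intro d
      by_cases hd : d = α
      · subst hd
        obtain ⟨c', hc'⟩ := (hVa1 c).2.2.2
        rw [h2α]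
        exact ⟨hB1, hB2, hB3, c', le01_trans hB4 hc'⟩
      · rw [h2d d hd]; exact hVa1 d
    have hD2 : Dom a2 := by
      intro d
      by_cases hd : d = α
      · subst hd
        obtain ⟨e, he⟩ := hDa1 c
        rw [h2α]
        exact ⟨e, le01_trans hB4 he⟩
      · rw [h2d d hd]; exact hDa1 d
    have hBX : ¬ Le01 (a0 ξ) B := by
      intro h
      obtain ⟨e, he⟩ := hDa1 c
      have := hξ e (le01_trans h (le01_trans hB4 he))
      exact hnle (le01_trans he (le01_trans this hα.2))
    have hlt : cls a2 ⊂ cls a1 := by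
      refine ⟨?_, fun h => ?_⟩
      · intro d hd
        by_cases hdα : d = α
        · subst hdα; exact hα
        · have hd' : OffIso01 (a2 d) (a0 ξ) := hd
          rw [h2d d hdα] at hd'
          exact hd'
      · have : OffIso01 (a2 α) (a0 ξ) := h (show α ∈ cls a1 from hα)
        rw [h2α] at this
        exact hBX this.2
    have := Set.ncard_lt_ncard hlt (Set.toFinite _)
    have := ha1min a2 hV2 hD2
    omega
  have hinj : Function.Injective a1 := by
    intro c d hcd
    obtain ⟨x, y, hx, hy, hxy⟩ := (hVa1 c).2.2.1
    have hd := (hVa1 d).2.2.1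
    rw [← hcd] at hd
    obtain ⟨x', y', hx', hy', hxy'⟩ := hd
    have e1 := (hVa1 c).2.1 x x' (hx.trans hx'.symm)
    have e2 := (hVa1 c).2.1 y y' (hy.trans hy'.symm)
    apply Subtype.ext
    rw [← hxy, ← hxy', e1, e2]
  refine ⟨Set.range a1, ⟨?_, ⟨?_, ?_⟩, ?_⟩, ⟨α.1, α.2, a1 α, ⟨α, rfl⟩, (hVa1 α).2.2.1, ?_⟩, ?_⟩
  · rintro _ ⟨d, rfl⟩; exact (hVa1 d).1
  · rintro _ ⟨d, rfl⟩; exact (hVa1 d).2.1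
  · intro c hc; exact ⟨_, ⟨⟨c, hc⟩, rfl⟩, (hVa1 ⟨c, hc⟩).2.2.1⟩
  · rw [← Set.image_univ, Set.ncard_image_of_injective _ hinj, Set.ncard_univ]
    simp [K]
  · rintro _ ⟨d, rfl⟩; exact hgood d
  · intro k l hkl hk0 hk1 hl0 hl1 c0k c0l c1k c1l
    rintro ⟨_, ⟨d, rfl⟩, _, ⟨d', rfl⟩, h1, h2, h3, h4⟩
    obtain ⟨c, hc⟩ := (hVa1 d).2.2.2
    obtain ⟨c', hc'⟩ := (hVa1 d').2.2.2
    exact ⟨A0 c, hA0 c, A0 c', hA0 c', covers_of_le01 hc hk0.symm hk0 hk1 h1,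
      covers_of_le01 hc hk1.symm hk0 hk1 h2, covers_of_le01 hc' hl0.symm hl0 hl1 h3,
      covers_of_le01 hc' hl1.symm hl0 hl1 h4⟩
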